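/- Let θ_j^{(k)} denote the DOC kernels associated with the BDF-k kernels, and set ρ₃ = 10/3, ρ₄ = 6, ρ₅ = 96/5. Then for each k ∈ {3, 4, 5} there exists a constant c > 1, independent of n, such that for all n ≥ k and all real numbers u₁, …, u_{k−1}: |∑_{ℓ=1}^{k−1} u_ℓ · ∑_{j=k}^{n} θ_{n−j}^{(k)} b_{j−ℓ}^{(k)}| ≤ (c·ρ_k/8)·(k/7)^{n−k} · ∑_{ℓ=1}^{k−1} |u_ℓ|. -/

import Mathlib

noncomputable def bdf3 : ℕ → ℝ
  | 0 => 11/6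
  | 1 => -(7/6)
  | 2 => 1/3
  | _ => 0

noncomputable def bdf4 : ℕ → ℝ
  | 0 => 25/12
  | 1 => -(23/12)
  | 2 => 13/12
  | 3 => -(1/4)
  | _ => 0

noncomputable def bdf5 : ℕ → ℝ
  | 0 => 137/60
  | 1 => -(163/60)
  | 2 => 137/60
  | 3 => -(21/20)
  | 4 => 1/5
  | _ => 0

/-- The DOC kernels associated with kernels `b`:
`θ₀ = 1/b₀` and `θ_j = -(1/b₀) * ∑_{s=1}^{j} θ_{j-s} b_s` for `j ≥ 1`. -/
noncomputable def doc (b : ℕ → ℝ) : ℕ → ℝ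
  | 0 => 1 / b 0
  | j+1 => -(1 / b 0) * ∑ s ∈ (Finset.Icc 1 (j+1)).attach, doc b ((j+1) - s.1) * b s.1
  decreasing_by
    have h := Finset.mem_Icc.mp s.2
    omega

theorem doc_succ (b : ℕ → ℝ) (j : ℕ) :
    doc b (j + 1) = -(1 / b 0) * ∑ s ∈ Finset.Icc 1 (j + 1), doc b (j + 1 - s) * b s := by
  rw [doc, Finset.sum_attach (Finset.Icc 1 (j + 1)) (fun s => doc b (j + 1 - s) * b s)]

/-- For kernels vanishing beyond index `L`, the DOC recursion has at most `L` terms. -/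
theorem doc_add_of_vanishing {b : ℕ → ℝ} {L : ℕ} (hL : 1 ≤ L) (hb : ∀ s, L < s → b s = 0)
    (m : ℕ) :
    doc b (m + L) = -(1 / b 0) * ∑ s ∈ Finset.Icc 1 L, doc b (m + (L - s)) * b s := by
  obtain ⟨L, rfl⟩ := Nat.exists_eq_add_of_le' hL
  rw [← add_assoc, doc_succ]
  congr 1
  rw [← Finset.sum_subset (s₁ := Finset.Icc 1 (L + 1)) (Finset.Icc_subset_Icc_right (by omega))]
  · refine Finset.sum_congr rfl fun s hs => ?_
    rw [Finset.mem_Icc] at hs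
    rw [add_assoc, Nat.add_sub_assoc hs.2]
  · intro s hs hs'
    simp only [Finset.mem_Icc] at hs hs'
    rw [hb s (by omega), mul_zero]

/-- A Lyapunov function dominating `θ ^ 2` and contracted by `r ^ 2` forces geometric decay. -/
theorem exists_abs_le_geometric_of_lyapunov {θ V : ℕ → ℝ} {r ε : ℝ} (hr : 0 ≤ r) (hε : 0 < ε)
    (hV : ∀ m, ε * θ m ^ 2 ≤ V m) (hstep : ∀ m, V (m + 1) ≤ r ^ 2 * V m) :
    ∃ C, ∀ m, |θ m| ≤ C * r ^ m := by
  have hdecay : ∀ m, V m ≤ r ^ (2 * m) * V 0 := by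
    intro m
    induction m with
    | zero => simp
    | succ m ih =>
      calc V (m + 1) ≤ r ^ 2 * V m := hstep m
        _ ≤ r ^ 2 * (r ^ (2 * m) * V 0) := by gcongr
        _ = r ^ (2 * (m + 1)) * V 0 := by ring
  have hV0 : 0 ≤ V 0 := le_trans (by positivity) (hV 0)
  refine ⟨√(V 0 / ε), fun m => abs_le_of_sq_le_sq ?_ (by positivity)⟩
  rw [mul_pow, Real.sq_sqrt (by positivity), div_mul_eq_mul_div, le_div_iff₀ hε]
  calc θ m ^ 2 * ε = ε * θ m ^ 2 := mul_comm _ _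
    _ ≤ r ^ (2 * m) * V 0 := (hV m).trans (hdecay m)
    _ = V 0 * (r ^ m) ^ 2 := by ring

/-- If the DOC kernels decay geometrically and the kernels have finite support, then the starting
values have a geometrically decaying effect. -/
theorem starting_effects_le_of_doc_decay {b : ℕ → ℝ} {r C ρ : ℝ} {k L : ℕ} (hr : 0 < r)
    (hρ : 0 < ρ) (hL : L ≤ k) (hb : ∀ j, k ≤ j → b j = 0)
    (hθ : ∀ m, |doc b m| ≤ C * r ^ m) :
    ∃ c : ℝ, 1 < c ∧ ∀ n : ℕ, k ≤ n → ∀ u : ℕ → ℝ,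
      |∑ ℓ ∈ Finset.Icc 1 L, u ℓ * ∑ j ∈ Finset.Icc k n, doc b (n - j) * b (j - ℓ)| ≤
        c * ρ / 8 * r ^ (n - k) * ∑ ℓ ∈ Finset.Icc 1 L, |u ℓ| := by
  have hC : 0 ≤ C := by simpa using (abs_nonneg _).trans (hθ 0)
  set w : ℕ → ℕ → ℝ := fun ℓ j => (r ^ (j - k))⁻¹ * |b (j - ℓ)|
  have hw : ∀ ℓ j, 0 ≤ w ℓ j := fun ℓ j => by positivity
  set M : ℝ := ∑ ℓ ∈ Finset.Icc 1 L, ∑ j ∈ Finset.Icc k (2 * k), w ℓ j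
  have hM : 0 ≤ M := Finset.sum_nonneg fun ℓ _ => Finset.sum_nonneg fun j _ => hw ℓ j
  have hinner : ∀ n, ∀ ℓ ∈ Finset.Icc 1 L,
      |∑ j ∈ Finset.Icc k n, doc b (n - j) * b (j - ℓ)| ≤ C * r ^ (n - k) * M := by
    intro n ℓ hℓ
    have hwsum : ∑ j ∈ Finset.Icc k n, w ℓ j ≤ ∑ j ∈ Finset.Icc k (2 * k), w ℓ j := by
      rw [← Finset.sum_filter_of_ne (p := fun j => j ≤ 2 * k)]
      · refine Finset.sum_le_sum_of_subset_of_nonneg (fun j hj => ?_) fun j _ _ => hw ℓ j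
        simp only [Finset.mem_filter, Finset.mem_Icc] at hj ⊢
        omega
      · intro j _ hne
        by_contra! hj
        rw [Finset.mem_Icc] at hℓ
        exact hne (by simp [w, hb (j - ℓ) (by omega)])
    calc |∑ j ∈ Finset.Icc k n, doc b (n - j) * b (j - ℓ)|
        ≤ ∑ j ∈ Finset.Icc k n, |doc b (n - j) * b (j - ℓ)| := Finset.abs_sum_le_sum_abs _ _
      _ ≤ ∑ j ∈ Finset.Icc k n, C * r ^ (n - k) * w ℓ j := by
          refine Finset.sum_le_sum fun j hj => ?_
          rw [Finset.mem_Icc] at hj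
          have hpow : r ^ (n - k) * (r ^ (j - k))⁻¹ = r ^ (n - j) := by
            rw [show n - k = n - j + (j - k) by omega, pow_add,
              mul_inv_cancel_right₀ (by positivity)]
          calc |doc b (n - j) * b (j - ℓ)| ≤ C * r ^ (n - j) * |b (j - ℓ)| := by
                rw [abs_mul]
                gcongr
                exact hθ _
            _ = C * r ^ (n - k) * w ℓ j := by rw [← hpow]; ring
      _ = C * r ^ (n - k) * ∑ j ∈ Finset.Icc k n, w ℓ j := by rw [Finset.mul_sum]
      _ ≤ C * r ^ (n - k) * M := by
          gcongr
          exact hwsum.trans (Finset.single_le_sum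
            (f := fun ℓ => ∑ j ∈ Finset.Icc k (2 * k), w ℓ j)
            (fun ℓ _ => Finset.sum_nonneg fun j _ => hw ℓ j) hℓ)
  have hc₀ : 0 ≤ 8 * (C * M) / ρ := by positivity
  refine ⟨2 + 8 * (C * M) / ρ, by linarith, fun n _ u => ?_⟩
  have hc : C * M ≤ (2 + 8 * (C * M) / ρ) * ρ / 8 := by
    have : (2 + 8 * (C * M) / ρ) * ρ / 8 = ρ / 4 + C * M := by field_simp; ring
    linarith
  calc |∑ ℓ ∈ Finset.Icc 1 L, u ℓ * ∑ j ∈ Finset.Icc k n, doc b (n - j) * b (j - ℓ)|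
      ≤ ∑ ℓ ∈ Finset.Icc 1 L, |u ℓ * ∑ j ∈ Finset.Icc k n, doc b (n - j) * b (j - ℓ)| :=
        Finset.abs_sum_le_sum_abs _ _
    _ ≤ ∑ ℓ ∈ Finset.Icc 1 L, C * r ^ (n - k) * M * |u ℓ| := by
        refine Finset.sum_le_sum fun ℓ hℓ => ?_
        rw [abs_mul, mul_comm]
        gcongr
        exact hinner n ℓ hℓ
    _ = C * M * r ^ (n - k) * ∑ ℓ ∈ Finset.Icc 1 L, |u ℓ| := by
        rw [← Finset.mul_sum]; ring
    _ ≤ (2 + 8 * (C * M) / ρ) * ρ / 8 * r ^ (n - k) * ∑ ℓ ∈ Finset.Icc 1 L, |u ℓ| := by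
        gcongr

theorem bdf3_eq_zero (j : ℕ) (hj : 3 ≤ j) : bdf3 j = 0 := by
  obtain ⟨j, rfl⟩ := Nat.exists_eq_add_of_le' hj
  rfl

theorem bdf4_eq_zero (j : ℕ) (hj : 4 ≤ j) : bdf4 j = 0 := by
  obtain ⟨j, rfl⟩ := Nat.exists_eq_add_of_le' hj
  rfl

theorem bdf5_eq_zero (j : ℕ) (hj : 5 ≤ j) : bdf5 j = 0 := by
  obtain ⟨j, rfl⟩ := Nat.exists_eq_add_of_le' hj
  rfl

theorem doc_bdf3_add_two (m : ℕ) :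
    doc bdf3 (m + 2) = 7 / 11 * doc bdf3 (m + 1) - 2 / 11 * doc bdf3 m := by
  rw [doc_add_of_vanishing (by norm_num) bdf3_eq_zero]
  norm_num [Finset.sum_Icc_succ_top, bdf3]
  ring

theorem doc_bdf4_add_three (m : ℕ) :
    doc bdf4 (m + 3) =
      23 / 25 * doc bdf4 (m + 2) - 13 / 25 * doc bdf4 (m + 1) + 3 / 25 * doc bdf4 m := by
  rw [doc_add_of_vanishing (by norm_num) bdf4_eq_zero]
  norm_num [Finset.sum_Icc_succ_top, bdf4]
  ring

theorem doc_bdf5_add_four (m : ℕ) :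
    doc bdf5 (m + 4) =
      163 / 137 * doc bdf5 (m + 3) - doc bdf5 (m + 2) + 63 / 137 * doc bdf5 (m + 1)
        - 12 / 137 * doc bdf5 m := by
  rw [doc_add_of_vanishing (by norm_num) bdf5_eq_zero]
  norm_num [Finset.sum_Icc_succ_top, bdf5]
  ring

theorem exists_abs_doc_bdf3_le : ∃ C, ∀ m, |doc bdf3 m| ≤ C * (3 / 7 : ℝ) ^ m := by
  let V : ℝ → ℝ → ℝ := fun x y => 54 * x ^ 2 - 190 * x * y + 300 * y ^ 2
  refine exists_abs_le_geometric_of_lyapunov (ε := 1 / 100)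
    (V := fun m => V (doc bdf3 m) (doc bdf3 (m + 1))) (by norm_num) (by norm_num)
    (fun m => ?_) fun m => ?_
  · generalize doc bdf3 m = x, doc bdf3 (m + 1) = y
    simp only [V]
    linarith [sq_nonneg (x - 9500 / 5399 * y), sq_nonneg y]
  · simp only [add_assoc, Nat.reduceAdd, doc_bdf3_add_two]
    generalize doc bdf3 m = x, doc bdf3 (m + 1) = y
    simp only [V]
    linarith [sq_nonneg (x - 65 / 6 * y), sq_nonneg y]

theorem exists_abs_doc_bdf4_le : ∃ C, ∀ m, |doc bdf4 m| ≤ C * (4 / 7 : ℝ) ^ m := by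
  let V : ℝ → ℝ → ℝ → ℝ := fun x y z =>
    9 * x ^ 2 + 125 * y ^ 2 + 200 * z ^ 2 - 60 * x * y + 44 * x * z - 250 * y * z
  refine exists_abs_le_geometric_of_lyapunov (ε := 1 / 100)
    (V := fun m => V (doc bdf4 m) (doc bdf4 (m + 1)) (doc bdf4 (m + 2)))
    (by norm_num) (by norm_num) (fun m => ?_) fun m => ?_
  · generalize doc bdf4 m = x, doc bdf4 (m + 1) = y, doc bdf4 (m + 2) = z
    simp only [V]
    linarith [sq_nonneg (x - 3000 / 899 * y + 2200 / 899 * z), sq_nonneg (y - 371 / 179 * z),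
      sq_nonneg z]
  · simp only [add_assoc, Nat.reduceAdd, doc_bdf4_add_three]
    generalize doc bdf4 m = x, doc bdf4 (m + 1) = y, doc bdf4 (m + 2) = z
    simp only [V]
    linarith [sq_nonneg (x + 3 / 4 * y + 127 / 72 * z), sq_nonneg (y - 2225 / 2858 * z),
      sq_nonneg z]

theorem exists_abs_doc_bdf5_le : ∃ C, ∀ m, |doc bdf5 m| ≤ C * (5 / 7 : ℝ) ^ m := by
  let V : ℝ → ℝ → ℝ → ℝ → ℝ := fun x y z t =>
    12 * x ^ 2 + 275 * y ^ 2 + 1000 * z ^ 2 + 730 * t ^ 2 - 106 * x * y + 166 * x * z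
      - 58 * x * t - 962 * y * z + 496 * y * t - 1398 * z * t
  refine exists_abs_le_geometric_of_lyapunov (ε := 1 / 100)
    (V := fun m => V (doc bdf5 m) (doc bdf5 (m + 1)) (doc bdf5 (m + 2)) (doc bdf5 (m + 3)))
    (by norm_num) (by norm_num) (fun m => ?_) fun m => ?_
  · generalize doc bdf5 m = x, doc bdf5 (m + 1) = y, doc bdf5 (m + 2) = z,
      doc bdf5 (m + 3) = t
    simp only [V]
    linarith [sq_nonneg (x - 5300 / 1199 * y + 8300 / 1199 * z - 2900 / 1199 * t),
      sq_nonneg (y - 136819 / 48825 * z + 47884 / 16275 * t),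
      sq_nonneg (z - 7934763 / 5159461 * t), sq_nonneg t]
  · simp only [add_assoc, Nat.reduceAdd, doc_bdf5_add_four]
    generalize doc bdf5 m = x, doc bdf5 (m + 1) = y, doc bdf5 (m + 2) = z,
      doc bdf5 (m + 3) = t
    simp only [V]
    linarith [sq_nonneg (x - 162929 / 479820 * y + 117683 / 479820 * z + 4541 / 43620 * t),
      sq_nonneg (y + 6698863 / 12873011 * z + 2092211 / 12873011 * t),
      sq_nonneg (z - 192044834 / 161546749 * t), sq_nonneg t]

theorem doc_starting_effects_decay :
    (∃ c : ℝ, 1 < c ∧ ∀ n : ℕ, 3 ≤ n → ∀ u : ℕ → ℝ,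
      |∑ ℓ ∈ Finset.Icc 1 2, u ℓ * ∑ j ∈ Finset.Icc 3 n, doc bdf3 (n - j) * bdf3 (j - ℓ)| ≤
        c * (10/3) / 8 * (3/7 : ℝ)^(n - 3) * ∑ ℓ ∈ Finset.Icc 1 2, |u ℓ|) ∧
    (∃ c : ℝ, 1 < c ∧ ∀ n : ℕ, 4 ≤ n → ∀ u : ℕ → ℝ,
      |∑ ℓ ∈ Finset.Icc 1 3, u ℓ * ∑ j ∈ Finset.Icc 4 n, doc bdf4 (n - j) * bdf4 (j - ℓ)| ≤
        c * 6 / 8 * (4/7 : ℝ)^(n - 4) * ∑ ℓ ∈ Finset.Icc 1 3, |u ℓ|) ∧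
    (∃ c : ℝ, 1 < c ∧ ∀ n : ℕ, 5 ≤ n → ∀ u : ℕ → ℝ,
      |∑ ℓ ∈ Finset.Icc 1 4, u ℓ * ∑ j ∈ Finset.Icc 5 n, doc bdf5 (n - j) * bdf5 (j - ℓ)| ≤
        c * (96/5) / 8 * (5/7 : ℝ)^(n - 5) * ∑ ℓ ∈ Finset.Icc 1 4, |u ℓ|) := by
  obtain ⟨C₃, h₃⟩ := exists_abs_doc_bdf3_le
  obtain ⟨C₄, h₄⟩ := exists_abs_doc_bdf4_le
  obtain ⟨C₅, h₅⟩ := exists_abs_doc_bdf5_le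
  exact ⟨starting_effects_le_of_doc_decay (by norm_num) (by norm_num) (by norm_num)
      bdf3_eq_zero h₃,
    starting_effects_le_of_doc_decay (by norm_num) (by norm_num) (by norm_num) bdf4_eq_zero h₄,
    starting_effects_le_of_doc_decay (by norm_num) (by norm_num) (by norm_num) bdf5_eq_zero h₅⟩
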